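/- For all finite sets X ⊆ X' of vertices of G and every ℵ₀-tangle τ of G, the pushforward f_{X',X}(U(τ,X')) of the ultrafilter U(τ,X') equals U(τ,X). -/

import Mathlib

open Set

variable {V : Type*}

/-- `{A,B}` is a separation of `G`: `A ∪ B = V` and no edge between `A∖B` and `B∖A`. -/
def IsSep (G : SimpleGraph V) (A B : Set V) : Prop :=
  A ∪ B = Set.univ ∧ ∀ a ∈ A \ B, ∀ b ∈ B \ A, ¬ G.Adj a b

/-- A separation of finite order. -/
def IsFinSep (G : SimpleGraph V) (A B : Set V) : Prop :=
  IsSep G A B ∧ (A ∩ B).Finite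

/-- The set `S⃗` of oriented finite-order separations of `G`, as ordered pairs. -/
def Svec (G : SimpleGraph V) : Set (Set V × Set V) :=
  {p | IsFinSep G p.1 p.2}

/-- `(A,B) ≤ (C,D)` iff `A ⊆ C` and `D ⊆ B`. -/
def sepLE (p q : Set V × Set V) : Prop :=
  p.1 ⊆ q.1 ∧ q.2 ⊆ p.2

/-- An orientation of the set `S` of finite-order separations: a subset of `S⃗` containing
exactly one of `(A,B)`, `(B,A)` for every finite-order separation `{A,B}`. -/
def IsOrientation (G : SimpleGraph V) (O : Set (Set V × Set V)) : Prop :=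
  O ⊆ Svec G ∧ ∀ A B : Set V, IsFinSep G A B → ((A, B) ∈ O ↔ (B, A) ∉ O)

/-- Consistency: no two distinct members `(B,A)`, `(C,D)` with `(A,B) < (C,D)`. -/
def Consistent (O : Set (Set V × Set V)) : Prop :=
  ∀ A B C D : Set V, (B, A) ∈ O → (C, D) ∈ O → (B, A) ≠ (C, D) →
    ¬ (sepLE (A, B) (C, D) ∧ (A, B) ≠ (C, D))

/-- A star in `S⃗`: every two distinct elements point towards each other. -/
def IsStar (G : SimpleGraph V) (σ : Set (Set V × Set V)) : Prop :=
  σ ⊆ Svec G ∧ ∀ p ∈ σ, ∀ q ∈ σ, p ≠ q → sepLE p (q.2, q.1)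

/-- Membership in `T_n`: a star of at most `n` elements whose target sides have finite
intersection. -/
def InTn (G : SimpleGraph V) (n : ℕ) (σ : Set (Set V × Set V)) : Prop :=
  IsStar G σ ∧ σ.Finite ∧ σ.ncard ≤ n ∧ (⋂ p ∈ σ, p.2).Finite

/-- Membership in `T`: an arbitrary star whose target sides have finite intersection. -/
def InT (G : SimpleGraph V) (σ : Set (Set V × Set V)) : Prop :=
  IsStar G σ ∧ (⋂ p ∈ σ, p.2).Finite

/-- An `ℵ₀`-tangle of `G`: a consistent orientation of `S` with no subset in `T₃`. -/
def IsTangle (G : SimpleGraph V) (τ : Set (Set V × Set V)) : Prop :=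
  IsOrientation G τ ∧ Consistent τ ∧ ∀ σ ⊆ τ, ¬ InTn G 3 σ

/-- A `T`-tangle of `S`: a consistent orientation of `S` with no subset in `T`. -/
def IsTTangle (G : SimpleGraph V) (τ : Set (Set V × Set V)) : Prop :=
  IsOrientation G τ ∧ Consistent τ ∧ ∀ σ ⊆ τ, ¬ InT G σ

/-- The set `𝒞_X` of (vertex sets of) connected components of `G − X`. -/
def Comps (G : SimpleGraph V) (X : Set V) : Set (Set V) :=
  {C | ∃ c : (G.induce Xᶜ).ConnectedComponent, C = Subtype.val '' c.supp}

/-- A collection of subsets of `α` is an ultrafilter on `α`. -/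
def IsUltra {α : Type*} (F : Set (Set α)) : Prop :=
  ∅ ∉ F ∧ (∀ s ∈ F, ∀ t ∈ F, s ∩ t ∈ F) ∧ (∀ s ∈ F, ∀ t : Set α, s ⊆ t → t ∈ F) ∧
    ∀ s : Set α, s ∈ F ∨ sᶜ ∈ F

/-- A principal ultrafilter, generated by a single point. -/
def IsPrincipalUF {α : Type*} (F : Set (Set α)) : Prop :=
  ∃ a : α, F = {s | a ∈ s}

/-- `U(τ,X)`: the collection of all sets `𝒮` of components of `G − X` with
`(⋃(𝒞_X∖𝒮) ∪ X, ⋃𝒮 ∪ X) ∈ τ`. -/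
def tangleUF (G : SimpleGraph V) (τ : Set (Set V × Set V)) (X : Set V) :
    Set (Set ↥(Comps G X)) :=
  {𝒮 | ((⋃ C ∈ 𝒮ᶜ, (C : Set V)) ∪ X, (⋃ C ∈ 𝒮, (C : Set V)) ∪ X) ∈ τ}

/-- `f_{X',X}`: the pushforward of an ultrafilter on `𝒞_{X'}` along the map sending each
component of `G − X'` to the component of `G − X` containing it. -/
def pushUF (G : SimpleGraph V) (X X' : Set V) (F : Set (Set ↥(Comps G X'))) :
    Set (Set ↥(Comps G X)) :=
  {𝒮 | {C' : ↥(Comps G X') | ∃ C ∈ 𝒮, (C' : Set V) ⊆ (C : Set V)} ∈ F}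

/-- A direction in `G`: a choice of a component of `G − X` for every finite `X ⊆ V`,
compatible under inclusion. -/
def IsDirection (G : SimpleGraph V) (f : Set V → Set V) : Prop :=
  (∀ X : Set V, X.Finite → f X ∈ Comps G X) ∧
    ∀ X X' : Set V, X.Finite → X'.Finite → X ⊆ X' → f X' ⊆ f X

theorem Comps.exists_mem (G : SimpleGraph V) {X : Set V} {v : V} (hv : v ∉ X) :
    ∃ C ∈ Comps G X, v ∈ C :=
  ⟨_, ⟨(G.induce Xᶜ).connectedComponentMk ⟨v, hv⟩, rfl⟩, ⟨v, hv⟩, rfl, rfl⟩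

theorem Comps.eq_of_mem {G : SimpleGraph V} {X C D : Set V} (hC : C ∈ Comps G X)
    (hD : D ∈ Comps G X) {v : V} (hvC : v ∈ C) (hvD : v ∈ D) : C = D := by
  obtain ⟨c, rfl⟩ := hC
  obtain ⟨d, rfl⟩ := hD
  obtain ⟨w, hw, rfl⟩ := hvC
  obtain ⟨w', hw', hww'⟩ := hvD
  obtain rfl := Subtype.ext hww'
  rw [← show _ = c from hw, ← show _ = d from hw']

theorem Comps.mem_of_adj {G : SimpleGraph V} {X C : Set V} (hC : C ∈ Comps G X) {v w : V}
    (hv : v ∈ C) (hw : w ∉ X) (h : G.Adj v w) : w ∈ C := by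
  obtain ⟨c, rfl⟩ := hC
  obtain ⟨v, rfl, rfl⟩ := hv
  have hadj : (G.induce Xᶜ).Adj ⟨w, hw⟩ v := h.symm
  exact ⟨⟨w, hw⟩, SimpleGraph.ConnectedComponent.sound hadj.reachable, rfl⟩

theorem Comps.exists_superset {G : SimpleGraph V} {X X' C' : Set V} (hXX' : X ⊆ X')
    (hC' : C' ∈ Comps G X') : ∃ C ∈ Comps G X, C' ⊆ C := by
  obtain ⟨c', rfl⟩ := hC'
  let φ := SimpleGraph.induceHomOfLE G (compl_subset_compl.2 hXX')
  refine ⟨_, ⟨c'.map φ.toHom, rfl⟩, ?_⟩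
  rintro _ ⟨v, rfl, rfl⟩
  exact ⟨φ v, rfl, rfl⟩

/-- A set of components of `G - X` induces a separation of `G`. -/
theorem isFinSep_comps (G : SimpleGraph V) {X : Set V} (hX : X.Finite)
    (𝒮 : Set ↥(Comps G X)) :
    IsFinSep G ((⋃ C ∈ 𝒮ᶜ, (C : Set V)) ∪ X) ((⋃ C ∈ 𝒮, (C : Set V)) ∪ X) := by
  refine ⟨⟨?_, ?_⟩, hX.subset ?_⟩
  · refine eq_univ_of_forall fun v => ?_
    by_cases hv : v ∈ X
    · exact Or.inl (Or.inr hv)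
    obtain ⟨C, hC, hvC⟩ := Comps.exists_mem G hv
    by_cases h : (⟨C, hC⟩ : ↥(Comps G X)) ∈ 𝒮
    · exact Or.inr (Or.inl (mem_biUnion h hvC))
    · exact Or.inl (Or.inl (mem_biUnion (s := 𝒮ᶜ) h hvC))
  · rintro a ⟨ha | ha, ha'⟩ b ⟨hb | hb, hb'⟩ hab
    · obtain ⟨C, hC, haC⟩ := mem_iUnion₂.1 ha
      have hbC := Comps.mem_of_adj C.2 haC (fun h => hb' (Or.inr h)) hab
      exact hb' (Or.inl (mem_biUnion hC hbC))
    · exact hb' (Or.inr hb)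
    · exact ha' (Or.inr ha)
    · exact ha' (Or.inr ha)
  · rintro v ⟨hA | hA, hB | hB⟩
    · obtain ⟨C, hC, hvC⟩ := mem_iUnion₂.1 hA
      obtain ⟨D, hD, hvD⟩ := mem_iUnion₂.1 hB
      exact absurd (Subtype.ext (Comps.eq_of_mem C.2 D.2 hvC hvD) ▸ hD) hC
    all_goals assumption

/-- If `𝒮'` is the set of components of `G - X'` that are contained in a component
belonging to `𝒮`, then `⋃ 𝒮'` and `⋃ 𝒮` agree up to `X'`. -/
theorem biUnion_comps_union {G : SimpleGraph V} {X X' : Set V} (hXX' : X ⊆ X')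
    (𝒮 : Set ↥(Comps G X)) :
    (⋃ C' ∈ {C' : ↥(Comps G X') | ∃ C ∈ 𝒮, (C' : Set V) ⊆ C}, (C' : Set V)) ∪ X' =
      ((⋃ C ∈ 𝒮, (C : Set V)) ∪ X) ∪ X' := by
  ext v
  by_cases hv : v ∈ X'
  · simp only [mem_union, hv, or_true]
  have hvX : v ∉ X := fun h => hv (hXX' h)
  simp only [mem_union, hv, hvX, or_false, mem_iUnion₂, exists_prop]
  constructor
  · rintro ⟨C', ⟨C, hC, hsub⟩, hvC'⟩
    exact ⟨C, hC, hsub hvC'⟩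
  · rintro ⟨C, hC, hvC⟩
    obtain ⟨C', hC', hvC'⟩ := Comps.exists_mem G hv
    obtain ⟨D, hD, hsub⟩ := Comps.exists_superset hXX' hC'
    obtain rfl := Comps.eq_of_mem hD C.2 (hsub hvC') hvC
    exact ⟨⟨C', hC'⟩, ⟨C, hC, hsub⟩, hvC'⟩

theorem compl_comps_subset {G : SimpleGraph V} {X X' : Set V} (hXX' : X ⊆ X')
    (𝒮 : Set ↥(Comps G X)) :
    {C' : ↥(Comps G X') | ∃ C ∈ 𝒮, (C' : Set V) ⊆ C}ᶜ =
      {C' : ↥(Comps G X') | ∃ C ∈ 𝒮ᶜ, (C' : Set V) ⊆ C} := by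
  ext ⟨C', hC'⟩
  constructor
  · intro h
    obtain ⟨C, hC, hsub⟩ := Comps.exists_superset hXX' hC'
    exact ⟨⟨C, hC⟩, fun hmem => h ⟨⟨C, hC⟩, hmem, hsub⟩, hsub⟩
  · rintro ⟨C, hC, hsub⟩ ⟨D, hD, hsub'⟩
    obtain ⟨c, rfl⟩ := hC'
    obtain ⟨v, hv⟩ := c.nonempty_supp
    have hv' := mem_image_of_mem Subtype.val hv
    exact hC (Subtype.ext (Comps.eq_of_mem C.2 D.2 (hsub hv') (hsub' hv')) ▸ hD)

theorem IsFinSep.symm {G : SimpleGraph V} {A B : Set V} (h : IsFinSep G A B) :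
    IsFinSep G B A :=
  ⟨⟨union_comm A B ▸ h.1.1, fun a ha b hb hab => h.1.2 b hb a ha hab.symm⟩,
    inter_comm A B ▸ h.2⟩

theorem IsFinSep.union_right {G : SimpleGraph V} {A B Y : Set V} (h : IsFinSep G A B)
    (hY : Y.Finite) : IsFinSep G A (B ∪ Y) := by
  refine ⟨⟨?_, ?_⟩, (h.2.union hY).subset ?_⟩
  · rw [← union_assoc, h.1.1, univ_union]
  · rintro a ⟨ha, ha'⟩ b ⟨-, hb'⟩
    refine h.1.2 a ⟨ha, fun hB => ha' (Or.inl hB)⟩ b ⟨?_, hb'⟩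
    exact (h.1.1.ge (mem_univ b)).resolve_left hb'
  · rintro v ⟨hA, hB | hv⟩
    exacts [Or.inl ⟨hA, hB⟩, Or.inr hv]

/-- The orientation of a tangle is closed downwards. -/
theorem IsTangle.mem_of_le {G : SimpleGraph V} {τ : Set (Set V × Set V)}
    (hτ : IsTangle G τ) {A B C D : Set V} (hAB : IsFinSep G A B) (hCD : (C, D) ∈ τ)
    (hle : sepLE (A, B) (C, D)) : (A, B) ∈ τ := by
  by_contra hn
  have hBA : (B, A) ∈ τ := by
    rw [hτ.1.2 B A hAB.symm]
    exact hn
  refine hτ.2.1 A B C D hBA hCD ?_ ⟨hle, fun h => hn (h ▸ hCD)⟩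
  intro h
  obtain ⟨rfl, rfl⟩ := Prod.mk.inj h
  refine hτ.2.2 {(B, A)} (singleton_subset_iff.2 hBA)
    ⟨⟨singleton_subset_iff.2 hAB.symm, ?_⟩, toFinite _, by simp, ?_⟩
  · rintro p rfl q rfl hpq
    exact absurd rfl hpq
  · rw [biInter_singleton]
    exact hAB.2.subset (subset_inter Subset.rfl hle.1)

/-- Enlarging both sides by a finite set does not change how a tangle orients a
separation. -/
theorem IsTangle.union_mem {G : SimpleGraph V} {τ : Set (Set V × Set V)}
    (hτ : IsTangle G τ) {A B Y : Set V} (hAB : (A, B) ∈ τ) (hY : Y.Finite) :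
    (A ∪ Y, B ∪ Y) ∈ τ := by
  have hsep : IsFinSep G A (B ∪ Y) := IsFinSep.union_right (hτ.1.1 hAB) hY
  have hsep' : IsFinSep G (A ∪ Y) (B ∪ Y) := (hsep.symm.union_right hY).symm
  have hmem : (A, B ∪ Y) ∈ τ := hτ.mem_of_le hsep hAB ⟨Subset.rfl, subset_union_left⟩
  rw [hτ.1.2 _ _ hsep']
  intro hrev
  refine hτ.2.2 {(A, B ∪ Y), (B ∪ Y, A ∪ Y)} (pair_subset hmem hrev)
    ⟨⟨pair_subset hsep hsep'.symm, ?_⟩, toFinite _, ?_, ?_⟩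
  · rintro p (rfl | rfl) q (rfl | rfl) hpq
    · exact absurd rfl hpq
    · exact ⟨subset_union_left, Subset.rfl⟩
    · exact ⟨Subset.rfl, subset_union_left⟩
    · exact absurd rfl hpq
  · refine (ncard_insert_le _ _).trans ?_
    rw [ncard_singleton]
    norm_num
  · rw [biInter_pair, inter_comm]
    exact hsep'.2

theorem IsTangle.union_mem_iff {G : SimpleGraph V} {τ : Set (Set V × Set V)}
    (hτ : IsTangle G τ) {A B Y : Set V} (hAB : IsFinSep G A B) (hY : Y.Finite) :
    (A ∪ Y, B ∪ Y) ∈ τ ↔ (A, B) ∈ τ := by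
  refine ⟨fun h => ?_, fun h => hτ.union_mem h hY⟩
  by_contra hn
  have hBA : (B, A) ∈ τ := by
    rw [hτ.1.2 B A hAB.symm]
    exact hn
  exact (hτ.1.2 _ _ (hτ.1.1 h)).1 h (hτ.union_mem hBA hY)

/-- Lemma 2.2: `f_{X',X}(U(τ,X')) = U(τ,X)` for all finite `X ⊆ X'`. -/
theorem stmt8 [Infinite V] (G : SimpleGraph V) (τ : Set (Set V × Set V))
    (hτ : IsTangle G τ) (X X' : Set V)
    (hX : X.Finite) (hX' : X'.Finite) (hXX' : X ⊆ X') :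
    pushUF G X X' (tangleUF G τ X') = tangleUF G τ X := by
  ext 𝒮
  change (_ ∪ X', _ ∪ X') ∈ τ ↔ (_ ∪ X, _ ∪ X) ∈ τ
  rw [compl_comps_subset hXX', biUnion_comps_union hXX', biUnion_comps_union hXX']
  exact hτ.union_mem_iff (isFinSep_comps G hX 𝒮) hX'
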